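/- Every finite chordal graph admits a perfect elimination ordering: an ordering (v_1, …, v_n) of its vertices such that for every i, the set of neighbours of v_i among {v_1, …, v_{i−1}} forms a clique. -/

import Mathlib

/-- A chord of a cycle `c` in a simple graph `Γ`: an edge of `Γ` joining two vertices of the
cycle which is not an edge of the cycle. -/
def SimpleGraph.Walk.HasChord {V : Type*} {Γ : SimpleGraph V} {v : V} (c : Γ.Walk v v) : Prop :=
  ∃ a b : V, a ∈ c.support ∧ b ∈ c.support ∧ Γ.Adj a b ∧ s(a, b) ∉ c.edges

/-- A simple graph is chordal if every cycle with more than 3 vertices admits a chord. -/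
def SimpleGraph.Chordal {V : Type*} (Γ : SimpleGraph V) : Prop :=
  ∀ (v : V) (c : Γ.Walk v v), c.IsCycle → 3 < c.length → c.HasChord

namespace SimpleGraph

variable {V : Type*}

/-- A walk realising the distance between its endpoints is chordless. -/
theorem Walk.isChordless_of_length_eq_dist {G : SimpleGraph V} {a b : V} (p : G.Walk a b)
    (hp : p.length = G.dist a b) : p.IsChordless := by
  have key : ∀ i j : ℕ, i ≤ j → j ≤ p.length → G.Adj (p.getVert i) (p.getVert j) →
      s(p.getVert i, p.getVert j) ∈ p.edges := by
    intro i j hij hj hadj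
    have hle := dist_le ((p.take i).append (Walk.cons hadj (p.drop j)))
    rw [← hp, Walk.length_append, Walk.length_cons, Walk.take_length, Walk.drop_length] at hle
    have hne : i ≠ j := by
      rintro rfl
      exact hadj.ne rfl
    obtain rfl : j = i + 1 := by omega
    rw [← Walk.mem_edges_toSubgraph, Subgraph.mem_edgeSet]
    exact p.toSubgraph_adj_getVert (by omega)
  rw [Walk.isChordless_iff_forall_mem_edges]
  intro u v hu hv huv
  obtain ⟨i, rfl, hi⟩ := Walk.mem_support_iff_exists_getVert.mp hu
  obtain ⟨j, rfl, hj⟩ := Walk.mem_support_iff_exists_getVert.mp hv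
  rcases le_total i j with h | h
  · exact key i j h hj huv
  · rw [Sym2.eq_swap]
    exact key j i h hi huv.symm

/-- In a chordal graph, two neighbours `a`, `b` of `x` that are joined by a path whose interior
avoids `x` and its neighbours are equal or adjacent. -/
theorem Chordal.adj_of_reachable {Γ H : SimpleGraph V} (hΓ : Γ.Chordal) {x a b : V} {W : Set V}
    (hH : ∀ u v, H.Adj u v ↔ Γ.Adj u v ∧ u ∈ W ∧ v ∈ W) (hx : x ∉ W)
    (hW : ∀ w ∈ W, Γ.Adj x w → w = a ∨ w = b)
    (hxa : Γ.Adj x a) (hxb : Γ.Adj x b) (ha : a ∈ W) (hab : a ≠ b) (hr : H.Reachable a b) :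
    Γ.Adj a b := by
  by_contra hnadj
  have hle : H ≤ Γ := fun u v h => ((hH u v).mp h).1
  obtain ⟨p, hp, hlen⟩ := hr.exists_path_of_dist
  have hchordless := p.isChordless_of_length_eq_dist hlen
  have hsupp : ∀ w ∈ p.support, w ∈ W := by
    intro w hw
    by_cases hwa : w = a
    · exact hwa ▸ ha
    · obtain ⟨i, rfl, hi⟩ := Walk.mem_support_iff_exists_getVert.mp hw
      obtain _ | i := i
      · simp at hwa
      · exact ((hH _ _).mp (p.adj_getVert_succ (i := i) (by omega))).2.2
  have hxp : x ∉ p.support := fun h => hx (hsupp x h)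
  have hlen2 : 2 ≤ p.length := by
    by_contra! h
    have h0 : p.length ≠ 0 := fun h => hab (Walk.eq_of_length_eq_zero h)
    exact hnadj (hle (Walk.adj_of_length_eq_one (p := p) (by omega)))
  let c : Γ.Walk x x := Walk.cons hxa ((p.mapLe hle).concat hxb.symm)
  have hc : c.IsCycle := by
    rw [Walk.cons_isCycle_iff, Walk.concat_isPath_iff, Walk.edges_concat]
    simp only [Walk.isPath_mapLe, Walk.support_mapLe_eq_support, Walk.edges_mapLe_eq_edges,
      List.concat_eq_append, List.mem_append, List.mem_singleton]
    refine ⟨⟨hp, hxp⟩, ?_⟩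
    rintro (h | h)
    · exact hxp (p.fst_mem_support_of_mem_edges h)
    · rw [Sym2.eq_swap, Sym2.congr_left] at h
      exact hab h
  have hcs : ∀ w, w ∈ c.support ↔ w = x ∨ w ∈ p.support := by
    intro w
    simp only [c, Walk.support_cons, Walk.support_concat, Walk.support_mapLe_eq_support,
      List.mem_append, List.mem_cons, List.not_mem_nil, or_false]
    tauto
  have hce : ∀ e, e ∈ c.edges ↔ e = s(x, a) ∨ e ∈ p.edges ∨ e = s(b, x) := by
    intro e
    simp [c, Walk.edges_concat]
  have hxc : ∀ w ∈ p.support, Γ.Adj x w → s(x, w) ∈ c.edges := by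
    intro w hw hadj
    rw [hce]
    rcases hW w (hsupp w hw) hadj with rfl | rfl
    · exact Or.inl rfl
    · exact Or.inr (Or.inr Sym2.eq_swap)
  obtain ⟨u, v, hu, hv, huv, hnot⟩ := hΓ x c hc (by
    simp only [c, Walk.length_cons, Walk.length_concat, Walk.length_mapLe]
    omega)
  rw [hcs] at hu hv
  rcases hu with rfl | hu
  · rcases hv with rfl | hv
    · exact huv.ne rfl
    · exact hnot (hxc v hv huv)
  · rcases hv with rfl | hv
    · exact hnot (Sym2.eq_swap ▸ hxc u hu huv.symm)
    · exact hnot ((hce _).mpr (Or.inr (Or.inl (hchordless.mem_edges hu hv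
        ((hH u v).mpr ⟨huv, hsupp u hu, hsupp v hv⟩)))))

/-- Dirac's lemma: if a set `S` of vertices of a chordal graph contains a vertex `y` distinct from
and not adjacent to `x`, then it contains such a vertex whose neighbours in `S` form a clique. -/
theorem Chordal.exists_isClique_neighborSet_inter_of_not_adj {Γ : SimpleGraph V}
    (hΓ : Γ.Chordal) (S : Finset V) :
    ∀ x ∈ S, ∀ y ∈ S, x ≠ y → ¬ Γ.Adj x y →
      ∃ v ∈ S, x ≠ v ∧ ¬ Γ.Adj x v ∧ Γ.IsClique (Γ.neighborSet v ∩ S) := by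
  classical
  induction S using Finset.strongInduction with
  | H S ih =>
  intro x hxS y hyS hxy hnxy
  let far : Set V := {w | w ∈ S ∧ x ≠ w ∧ ¬ Γ.Adj x w}
  let K : SimpleGraph V :=
    { Adj := fun u v => Γ.Adj u v ∧ u ∈ far ∧ v ∈ far
      symm := ⟨fun u v h => ⟨h.1.symm, h.2.2, h.2.1⟩⟩
      loopless := ⟨fun u h => h.1.ne rfl⟩ }
  let C : Finset V := S.filter fun w => w ∈ far ∧ K.Reachable y w
  let T : Finset V := S.filter fun w => Γ.Adj x w ∧ ∃ c ∈ C, Γ.Adj w c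
  have hC : ∀ w, w ∈ C ↔ w ∈ far ∧ K.Reachable y w := by
    intro w
    simp only [C, Finset.mem_filter, and_iff_right_iff_imp]
    exact fun h => h.1.1
  have hT : ∀ w, w ∈ T ↔ w ∈ S ∧ Γ.Adj x w ∧ ∃ c ∈ C, Γ.Adj w c := by simp [T]
  have hyC : y ∈ C := (hC y).mpr ⟨⟨hyS, hxy, hnxy⟩, Reachable.refl y⟩
  have hTclique : Γ.IsClique (T : Set V) := by
    intro a ha b hb hab
    obtain ⟨haS, hxa, c, hcC, hac⟩ := (hT a).mp ha
    obtain ⟨hbS, hxb, d, hdC, hbd⟩ := (hT b).mp hb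
    rw [hC] at hcC hdC
    let W : Set V := insert a (insert b far)
    let H : SimpleGraph V :=
      { Adj := fun u v => Γ.Adj u v ∧ u ∈ W ∧ v ∈ W
        symm := ⟨fun u v h => ⟨h.1.symm, h.2.2, h.2.1⟩⟩
        loopless := ⟨fun u h => h.1.ne rfl⟩ }
    have hfar : far ⊆ W := fun w hw => Or.inr (Or.inr hw)
    have hKH : K ≤ H := fun u v h => ⟨h.1, hfar h.2.1, hfar h.2.2⟩
    have hcd : H.Reachable c d := (hcC.2.symm.trans hdC.2).mono hKH
    have hacH : H.Adj a c := ⟨hac, Or.inl rfl, hfar hcC.1⟩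
    have hbdH : H.Adj b d := ⟨hbd, Or.inr (Or.inl rfl), hfar hdC.1⟩
    refine hΓ.adj_of_reachable (H := H) (W := W) (fun u v => Iff.rfl) ?_ ?_ hxa hxb (Or.inl rfl)
      hab ((hacH.reachable.trans hcd).trans hbdH.symm.reachable)
    · rintro (h | h | h)
      · exact hxa.ne h
      · exact hxb.ne h
      · exact h.2.1 rfl
    · rintro w (h | h | h) hxw
      · exact Or.inl h
      · exact Or.inr h
      · exact absurd hxw h.2.2
  have hnbr : ∀ v ∈ C, ∀ w ∈ S, Γ.Adj v w → w ∈ C ∪ T := by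
    intro v hv w hw hvw
    have hv' := (hC v).mp hv
    rw [Finset.mem_union]
    by_cases hxw : Γ.Adj x w
    · exact Or.inr ((hT w).mpr ⟨hw, hxw, v, hv, hvw.symm⟩)
    · have hwfar : w ∈ far := ⟨hw, fun h => hv'.1.2.2 (h ▸ hvw.symm), hxw⟩
      have hK : K.Adj v w := ⟨hvw, hv'.1, hwfar⟩
      exact Or.inl ((hC w).mpr ⟨hwfar, hv'.2.trans hK.reachable⟩)
  have hss : C ∪ T ⊂ S := by
    refine (Finset.ssubset_iff_of_subset ?_).mpr ⟨x, hxS, ?_⟩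
    · exact Finset.union_subset (Finset.filter_subset _ _) (Finset.filter_subset _ _)
    · rw [Finset.mem_union, hC, hT]
      rintro (h | h)
      · exact h.1.2.1 rfl
      · exact h.2.1.ne rfl
  suffices h : ∃ v ∈ C, Γ.IsClique (Γ.neighborSet v ∩ ↑(C ∪ T)) by
    obtain ⟨v, hvC, hv⟩ := h
    have hv' := ((hC v).mp hvC).1
    refine ⟨v, hv'.1, hv'.2.1, hv'.2.2, IsClique.subset ?_ hv⟩
    exact fun w hw => ⟨hw.1, hnbr v hvC w hw.2 hw.1⟩
  by_cases hTuniv : ∃ t ∈ T, ∃ z ∈ C ∪ T, t ≠ z ∧ ¬ Γ.Adj t z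
  · obtain ⟨t, ht, z, hz, htz, hntz⟩ := hTuniv
    obtain ⟨v, hv, htv, hntv, hcl⟩ := ih _ hss t (Finset.mem_union_right _ ht) z hz htz hntz
    refine ⟨v, (Finset.mem_union.mp hv).resolve_right fun hvT => ?_, hcl⟩
    exact hntv (hTclique ht hvT htv)
  · push Not at hTuniv
    by_cases hCuniv : ∃ c ∈ C, ∃ z ∈ C ∪ T, c ≠ z ∧ ¬ Γ.Adj c z
    · obtain ⟨c, hc, z, hz, hcz, hncz⟩ := hCuniv
      obtain ⟨v, hv, hcv, hncv, hcl⟩ := ih _ hss c (Finset.mem_union_left _ hc) z hz hcz hncz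
      refine ⟨v, (Finset.mem_union.mp hv).resolve_right fun hvT => ?_, hcl⟩
      exact hncv (hTuniv v hvT c (Finset.mem_union_left _ hc) hcv.symm).symm
    · push Not at hCuniv
      refine ⟨y, hyC, fun u hu w hw huw => ?_⟩
      rcases Finset.mem_union.mp hu.2 with h | h
      · exact hCuniv u h w hw.2 huw
      · exact hTuniv u h w hw.2 huw

/-- Every nonempty finite set `S` of vertices of a chordal graph contains a vertex whose neighbours
in `S` form a clique. -/
theorem Chordal.exists_isClique_neighborSet_inter {Γ : SimpleGraph V} (hΓ : Γ.Chordal)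
    {S : Finset V} (hS : S.Nonempty) : ∃ v ∈ S, Γ.IsClique (Γ.neighborSet v ∩ S) := by
  by_cases h : ∃ x ∈ S, ∃ y ∈ S, x ≠ y ∧ ¬ Γ.Adj x y
  · obtain ⟨x, hx, y, hy, hxy, hnxy⟩ := h
    obtain ⟨v, hv, -, -, hcl⟩ :=
      hΓ.exists_isClique_neighborSet_inter_of_not_adj S x hx y hy hxy hnxy
    exact ⟨v, hv, hcl⟩
  · push Not at h
    obtain ⟨v, hv⟩ := hS
    exact ⟨v, hv, fun u hu w hw huw => h u hu.2 w hw.2 huw⟩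

/-- Every finite set `S` of vertices of a chordal graph can be numbered by `0, …, #S - 1` so that
the neighbours of each vertex with a smaller number form a clique. -/
theorem Chordal.exists_elimination_numbering {Γ : SimpleGraph V} (hΓ : Γ.Chordal)
    (S : Finset V) :
    ∃ f : V → ℕ, Set.InjOn f S ∧ (∀ v ∈ S, f v < S.card) ∧
      ∀ v ∈ S, Γ.IsClique (Γ.neighborSet v ∩ {u | u ∈ S ∧ f u < f v}) := by
  classical
  induction S using Finset.strongInduction with
  | H S ih =>
  rcases S.eq_empty_or_nonempty with rfl | hS
  · exact ⟨fun _ => 0, by simp⟩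
  obtain ⟨s, hs, hcl⟩ := hΓ.exists_isClique_neighborSet_inter hS
  obtain ⟨f, hinj, hlt, hf⟩ := ih _ (Finset.erase_ssubset hs)
  have hcard := Finset.card_erase_add_one hs
  have hmem : ∀ v ∈ S, v ≠ s → v ∈ S.erase s := fun v hv hvs => Finset.mem_erase.mpr ⟨hvs, hv⟩
  let g : V → ℕ := fun v => if v = s then (S.erase s).card else f v
  have hgs : g s = (S.erase s).card := if_pos rfl
  have hg : ∀ v, v ≠ s → g v = f v := fun v hv => if_neg hv
  have hglt : ∀ v ∈ S, v ≠ s → g v < g s := by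
    intro v hv hvs
    rw [hg v hvs, hgs]
    exact hlt v (hmem v hv hvs)
  refine ⟨g, ?_, ?_, ?_⟩
  · intro u hu v hv huv
    by_cases hus : u = s <;> by_cases hvs : v = s
    · rw [hus, hvs]
    · exact absurd (hus ▸ huv).symm (hglt v hv hvs).ne
    · exact absurd (hvs ▸ huv) (hglt u hu hus).ne
    · rw [hg u hus, hg v hvs] at huv
      exact hinj (hmem u hu hus) (hmem v hv hvs) huv
  · intro v hv
    by_cases hvs : v = s
    · rw [hvs, hgs]
      omega
    · have := hglt v hv hvs
      omega
  · intro v hv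
    by_cases hvs : v = s
    · subst hvs
      refine IsClique.subset ?_ hcl
      exact fun u hu => ⟨hu.1, hu.2.1⟩
    · refine IsClique.subset ?_ (hf v (hmem v hv hvs))
      refine fun u hu => ⟨hu.1, ?_⟩
      have hus : u ≠ s := by
        rintro rfl
        exact absurd hu.2.2 (hglt v hv hvs).asymm
      refine ⟨hmem u hu.2.1 hus, ?_⟩
      rw [← hg u hus, ← hg v hvs]
      exact hu.2.2

end SimpleGraph

/-- Every finite chordal graph admits a perfect elimination ordering: an ordering
`v_1, …, v_n` of the vertices such that for each `i` the neighbours of `v_i` among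
`v_1, …, v_{i-1}` form a clique. -/
theorem chordal_perfect_elimination_ordering {V : Type*} [Fintype V]
    (Γ : SimpleGraph V) (hΓ : Γ.Chordal) :
    ∃ e : Fin (Fintype.card V) ≃ V,
      ∀ i j k : Fin (Fintype.card V), j < i → k < i → j ≠ k →
        Γ.Adj (e j) (e i) → Γ.Adj (e k) (e i) → Γ.Adj (e j) (e k) := by
  obtain ⟨f, hinj, hlt, hf⟩ := hΓ.exists_elimination_numbering Finset.univ
  let g : V → Fin (Fintype.card V) := fun v => ⟨f v, hlt v (Finset.mem_univ v)⟩
  have hg : Function.Bijective g := by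
    rw [Fintype.bijective_iff_injective_and_card]
    exact ⟨fun u v huv => hinj (Finset.mem_coe.mpr (Finset.mem_univ u))
      (Finset.mem_coe.mpr (Finset.mem_univ v)) (Fin.mk.inj huv), by simp⟩
  let e := (Equiv.ofBijective g hg).symm
  have he : ∀ i, f (e i) = i := fun i =>
    congrArg Fin.val ((Equiv.ofBijective g hg).apply_symm_apply i)
  refine ⟨e, fun i j k hji hki hjk haj hak => ?_⟩
  refine hf (e i) (Finset.mem_univ _) ⟨haj.symm, Finset.mem_univ _, ?_⟩
    ⟨hak.symm, Finset.mem_univ _, ?_⟩ (e.injective.ne hjk)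
  · rw [he, he]
    exact hji
  · rw [he, he]
    exact hki
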